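/- Let d ≥ 1 and let φ : 𝔻^d → 𝔻^d be a holomorphic map with ‖φ‖_∞ := sup_{z ∈ 𝔻^d} max_{1 ≤ j ≤ d} |φ_j(z)| < 1, and suppose there exists a bounded linear operator T on ℓ²(ℕ^d) which is the composition operator C_φ. Then there exist constants 0 < c ≤ C < ∞, independent of n, such that a_n(T) ≤ C · exp(−c · n^{1/d}) for all n ≥ 1. -/

import Mathlib

open scoped ENNReal

noncomputable section

/-- The open unit polydisk in `ℂ^d`. -/
def polydisk (d : ℕ) : Set (Fin d → ℂ) := {z | ∀ j, ‖z j‖ < 1}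

/-- The Hardy space of the polydisk, identified with `ℓ²(ℕ^d)` via Taylor coefficients. -/
abbrev H2 (d : ℕ) := lp (fun _ : Fin d → ℕ => ℂ) 2

/-- Approximation numbers of a bounded operator: `a_n(T) = inf {‖T - R‖ : rank R < n}`. -/
def approxNumber {H : Type} [NormedAddCommGroup H] [NormedSpace ℂ H]
    (T : H →L[ℂ] H) (n : ℕ) : ℝ :=
  sInf {c : ℝ | ∃ R : H →L[ℂ] H, LinearMap.rank (R : H →ₗ[ℂ] H) < (n : Cardinal) ∧ c = ‖T - R‖}

/-- `T` is the composition operator `C_φ` on `H²(𝔻^d) ≃ ℓ²(ℕ^d)`: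
for every `c ∈ ℓ²(ℕ^d)` and `z ∈ 𝔻^d`, the series `∑_α c_α φ(z)^α` converges absolutely
and equals `∑_α (T c)_α z^α` (also absolutely convergent). -/
def IsCompositionOperator {d : ℕ} (φ : (Fin d → ℂ) → (Fin d → ℂ))
    (T : H2 d →L[ℂ] H2 d) : Prop :=
  ∀ c : H2 d, ∀ z ∈ polydisk d,
    Summable (fun α : Fin d → ℕ => ‖(c α * ∏ j, (φ z j) ^ (α j) : ℂ)‖) ∧
    Summable (fun α : Fin d → ℕ => ‖((T c) α * ∏ j, (z j) ^ (α j) : ℂ)‖) ∧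
    (∑' α : Fin d → ℕ, c α * ∏ j, (φ z j) ^ (α j))
      = ∑' α : Fin d → ℕ, (T c) α * ∏ j, (z j) ^ (α j)


section Parseval

open MeasureTheory UnitAddTorus

/-- The measure on `ℝ / ℤ`, normalised as in Mathlib's multivariate Fourier file. -/
local instance : MeasureSpace UnitAddCircle := ⟨AddCircle.haarAddCircle⟩

local instance : Measure.IsAddHaarMeasure (volume : Measure UnitAddCircle) :=
  inferInstanceAs (Measure.IsAddHaarMeasure AddCircle.haarAddCircle)

local instance : IsProbabilityMeasure (volume : Measure UnitAddCircle) :=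
  inferInstanceAs (IsProbabilityMeasure AddCircle.haarAddCircle)

lemma aux_toLp_norm_le {d : ℕ} (F : C(UnitAddTorus (Fin d), ℂ)) :
    ‖ContinuousMap.toLp (E := ℂ) 2 volume ℂ F‖ ≤ ‖F‖ := by
  have h1 := ContinuousMap.toLp_norm_le (E := ℂ) (p := 2) (𝕜 := ℂ)
    (volume : Measure (UnitAddTorus (Fin d)))
  have h2 : (measureUnivNNReal (volume : Measure (UnitAddTorus (Fin d)))) = 1 := by
    simp [measureUnivNNReal]
  rw [h2] at h1
  simp only [NNReal.coe_one, Real.one_rpow] at h1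
  calc _ ≤ _ := ContinuousLinearMap.le_opNorm _ _
    _ ≤ 1 * ‖F‖ := by gcongr
    _ = ‖F‖ := one_mul _

/-- Bessel-type inequality for an absolutely convergent Fourier series. -/
lemma aux_bessel {d : ℕ} (a : (Fin d → ℕ) → ℂ) (ha : Summable fun α => ‖a α‖) (M : ℝ)
    (hM0 : 0 ≤ M)
    (hM : ∀ x : UnitAddTorus (Fin d),
      ‖∑' α : Fin d → ℕ, a α * mFourier (fun j => (α j : ℤ)) x‖ ≤ M)
    (s : Finset (Fin d → ℕ)) : ∑ α ∈ s, ‖a α‖ ^ 2 ≤ M ^ 2 := by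
  classical
  set e : (Fin d → ℕ) → (Fin d → ℤ) := fun α j => (α j : ℤ) with he
  have hinj : Function.Injective e := by
    intro α β h
    funext j
    have := congrFun h j
    simpa [he] using this
  have hsum : Summable (fun α => a α • mFourier (e α)) := by
    apply Summable.of_norm
    simpa [norm_smul, mFourier_norm] using ha
  obtain ⟨F, hF⟩ := hsum
  have hFn : ‖F‖ ≤ M := by
    rw [ContinuousMap.norm_le _ hM0]
    intro x
    have h := hF.map (ContinuousMap.evalCLM ℂ x : C(UnitAddTorus (Fin d), ℂ) →L[ℂ] ℂ)
      (ContinuousLinearMap.continuous _)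
    have h' : HasSum (fun α => a α * mFourier (e α) x) (F x) := by
      simpa [Function.comp_def] using h
    rw [← h'.tsum_eq]
    exact hM x
  have horth : Orthonormal ℂ (fun α => mFourierLp (d := Fin d) 2 (e α)) :=
    orthonormal_mFourier.comp e hinj
  have hL : HasSum (fun α => a α • mFourierLp (d := Fin d) 2 (e α))
      (ContinuousMap.toLp (E := ℂ) 2 volume ℂ F) := by
    have h := hF.map (ContinuousMap.toLp (E := ℂ) 2
      (volume : Measure (UnitAddTorus (Fin d))) ℂ) (ContinuousLinearMap.continuous _)
    simpa [Function.comp_def] using h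
  have hin : ∀ β, inner ℂ (mFourierLp (d := Fin d) 2 (e β))
      (ContinuousMap.toLp (E := ℂ) 2 volume ℂ F) = a β := by
    intro β
    have h := hL.map (innerSL ℂ (mFourierLp (d := Fin d) 2 (e β)))
      (ContinuousLinearMap.continuous _)
    have h2 : HasSum (fun α => if α = β then a β else 0)
        (inner ℂ (mFourierLp (d := Fin d) 2 (e β))
          (ContinuousMap.toLp (E := ℂ) 2 volume ℂ F)) := by
      rw [innerSL_apply_apply] at h
      convert h using 1
      funext α
      simp only [Function.comp_apply, map_smul, innerSL_apply_apply, smul_eq_mul]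
      rw [orthonormal_iff_ite.mp horth β α]
      by_cases hab : α = β
      · simp [hab]
      · simp [hab, Ne.symm hab]
    exact h2.unique (hasSum_ite_eq β (a β))
  have hb := horth.sum_inner_products_le (s := s) (ContinuousMap.toLp (E := ℂ) 2 volume ℂ F)
  simp only [hin] at hb
  refine hb.trans ?_
  have := aux_toLp_norm_le F
  gcongr
  exact this.trans hFn

end Parseval

/-- The `ℓ²` norm of the coefficients is at most the sup norm on the polydisk. -/
lemma aux_norm_le {d : ℕ} (b : H2 d) (M : ℝ) (hM0 : 0 ≤ M)
    (hs : ∀ z ∈ polydisk d, Summable (fun α : Fin d → ℕ => ‖(b α * ∏ j, (z j) ^ (α j) : ℂ)‖))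
    (hM : ∀ z ∈ polydisk d, ‖∑' α : Fin d → ℕ, b α * ∏ j, (z j) ^ (α j)‖ ≤ M) :
    ‖b‖ ≤ M := by
  refine lp.norm_le_of_forall_sum_le (by norm_num) hM0 fun s => ?_
  simp only [ENNReal.toReal_ofNat, Real.rpow_ofNat]
  have key : ∀ ρ : ℝ, 0 < ρ → ρ < 1 →
      ∑ α ∈ s, ‖b α * ∏ j, (ρ : ℂ) ^ (α j)‖ ^ 2 ≤ M ^ 2 := by
    intro ρ h0 h1
    apply aux_bessel (fun α => b α * ∏ j, (ρ : ℂ) ^ (α j)) _ M hM0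
    · intro x
      have hz : (fun j => (ρ : ℂ) * fourier 1 (x j)) ∈ polydisk d := by
        intro j
        rw [norm_mul, fourier_apply, Circle.norm_coe, mul_one, Complex.norm_real,
          Real.norm_of_nonneg h0.le]
        exact h1
      have := hM _ hz
      convert this using 4 with α
      simp only [mul_pow, Finset.prod_mul_distrib, mul_assoc]
      congr 2
      simp only [UnitAddTorus.mFourier, ContinuousMap.coe_mk]
      refine Finset.prod_congr rfl fun j _ => ?_
      simp [fourier_apply, AddCircle.toCircle_nsmul]
    · exact hs (fun _ => (ρ : ℂ)) (fun j => by simp [abs_of_pos h0, h1])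
  have hcont : Filter.Tendsto (fun ρ : ℝ => ∑ α ∈ s, ‖b α * ∏ j, (ρ : ℂ) ^ (α j)‖ ^ 2)
      (nhdsWithin 1 (Set.Iio 1)) (nhds (∑ α ∈ s, ‖b α‖ ^ 2)) := by
    have : Continuous (fun ρ : ℝ => ∑ α ∈ s, ‖b α * ∏ j, (ρ : ℂ) ^ (α j)‖ ^ 2) := by
      fun_prop
    have h := this.tendsto 1
    simp only [Complex.ofReal_one, one_pow, Finset.prod_const_one, mul_one] at h
    exact h.mono_left nhdsWithin_le_nhds
  refine le_of_tendsto hcont ?_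
  filter_upwards [Ioo_mem_nhdsLT (show (0 : ℝ) < 1 by norm_num)] with ρ hρ
  exact key ρ hρ.1 hρ.2

/-- Geometric summability over multi-indices. -/
lemma aux_geom (d : ℕ) (q : ℝ) (h0 : 0 ≤ q) (h1 : q < 1) :
    Summable (fun α : Fin d → ℕ => ∏ j, q ^ (α j)) := by
  classical
  refine summable_of_sum_le (c := ((1 - q)⁻¹) ^ d)
    (fun α => Finset.prod_nonneg fun j _ => pow_nonneg h0 _) fun u => ?_
  set N := (u.sup fun α => Finset.univ.sup α) + 1 with hN
  have hsub : u ⊆ Fintype.piFinset (fun _ : Fin d => Finset.range N) := by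
    intro α hα
    rw [Fintype.mem_piFinset]
    intro j
    rw [Finset.mem_range, hN, Nat.lt_succ_iff]
    exact (Finset.le_sup (f := α) (Finset.mem_univ j)).trans
      (Finset.le_sup (f := fun α : Fin d → ℕ => Finset.univ.sup α) hα)
  calc ∑ α ∈ u, ∏ j, q ^ (α j)
      ≤ ∑ α ∈ Fintype.piFinset (fun _ : Fin d => Finset.range N), ∏ j, q ^ (α j) :=
        Finset.sum_le_sum_of_subset_of_nonneg hsub
          fun α _ _ => Finset.prod_nonneg fun j _ => pow_nonneg h0 _
    _ = ∏ _j : Fin d, ∑ k ∈ Finset.range N, q ^ k :=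
        (Finset.prod_univ_sum (fun _ : Fin d => Finset.range N) (fun _ k => q ^ k)).symm
    _ = (∑ k ∈ Finset.range N, q ^ k) ^ d := by simp
    _ ≤ ((1 - q)⁻¹) ^ d := by
        gcongr
        rw [← tsum_geometric_of_lt_one h0 h1]
        exact (summable_geometric_of_lt_one h0 h1).sum_le_tsum _ fun _ _ => pow_nonneg h0 _

/-- Truncation to the box `α_j < m` gives an exponentially small error. -/
lemma aux_trunc {d : ℕ} (φ : (Fin d → ℂ) → (Fin d → ℂ)) (q : ℝ) (h0 : 0 ≤ q) (h1 : q < 1)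
    (hq : ∀ z ∈ polydisk d, ∀ j, ‖φ z j‖ ≤ q ^ 2)
    (T : H2 d →L[ℂ] H2 d) (hT : IsCompositionOperator φ T) (m : ℕ) :
    ∃ R : H2 d →L[ℂ] H2 d, LinearMap.rank (R : H2 d →ₗ[ℂ] H2 d) ≤ ((m ^ d : ℕ) : Cardinal) ∧
      ‖T - R‖ ≤ (∑' α : Fin d → ℕ, ∏ j, q ^ (α j)) * q ^ m := by
  classical
  set K := ∑' α : Fin d → ℕ, ∏ j, q ^ (α j) with hK
  have hgeom := aux_geom d q h0 h1
  have hK0 : 0 ≤ K := tsum_nonneg fun α => Finset.prod_nonneg fun j _ => pow_nonneg h0 _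
  set S : Finset (Fin d → ℕ) := Fintype.piFinset (fun _ : Fin d => Finset.range m) with hS
  have hcard : S.card = m ^ d := by simp [hS]
  let v : (Fin d → ℕ) → H2 d := fun α => T (lp.single 2 α (1 : ℂ))
  let R : H2 d →L[ℂ] H2 d :=
    ∑ α ∈ S, (lp.evalCLM ℂ (fun _ : Fin d → ℕ => ℂ) 2 α).smulRight (v α)
  have hR : ∀ c, R c = ∑ α ∈ S, c α • v α := by
    intro c
    simp [R, lp.evalCLM]
  refine ⟨R, ?_, ?_⟩
  · have hle : LinearMap.range (R : H2 d →ₗ[ℂ] H2 d) ≤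
        Submodule.span ℂ ((S.image v : Finset (H2 d)) : Set (H2 d)) := by
      rintro _ ⟨c, rfl⟩
      rw [ContinuousLinearMap.coe_coe, hR]
      refine Submodule.sum_mem _ fun α hα => Submodule.smul_mem _ _ (Submodule.subset_span ?_)
      exact Finset.mem_coe.mpr (Finset.mem_image_of_mem v hα)
    calc LinearMap.rank (R : H2 d →ₗ[ℂ] H2 d)
        ≤ Module.rank ℂ (Submodule.span ℂ ((S.image v : Finset (H2 d)) : Set (H2 d))) :=
          Submodule.rank_mono hle
      _ ≤ ((S.image v).card : Cardinal) := rank_span_finset_le _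
      _ ≤ ((m ^ d : ℕ) : Cardinal) := by
          rw [← hcard]
          exact_mod_cast Finset.card_image_le
  · refine ContinuousLinearMap.opNorm_le_bound _ (by positivity) fun c => ?_
    set c' : H2 d := c - ∑ α ∈ S, lp.single 2 α (c α) with hc'
    have hTc : (T - R) c = T c' := by
      rw [sub_apply, hR, hc', map_sub, map_sum]
      congr 1
      refine Finset.sum_congr rfl fun α _ => ?_
      rw [← map_smul, ← lp.single_smul, smul_eq_mul, mul_one]
    have hc'v : ∀ β, c' β = if β ∈ S then 0 else c β := by
      intro β
      rw [hc', lp.coeFn_sub, Pi.sub_apply, lp.coeFn_sum, Finset.sum_apply]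
      simp only [lp.coeFn_single, Finset.sum_pi_single]
      split_ifs <;> simp
    rw [hTc]
    refine aux_norm_le _ _ (by positivity) (fun z hz => (hT c' z hz).2.1) fun z hz => ?_
    rw [← (hT c' z hz).2.2]
    have hterm : ∀ α : Fin d → ℕ, ‖(c' α * ∏ j, (φ z j) ^ (α j) : ℂ)‖ ≤
        (∏ j, q ^ (α j)) * (q ^ m * ‖c‖) := by
      intro α
      have hP : 0 ≤ ∏ j, q ^ (α j) := Finset.prod_nonneg fun j _ => pow_nonneg h0 _
      rw [hc'v]
      split_ifs with hα
      · simp only [zero_mul, norm_zero]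
        positivity
      · have hnot : ∃ j, m ≤ α j := by
          by_contra! hcon
          exact hα (by simpa [hS, Fintype.mem_piFinset] using hcon)
        obtain ⟨j₀, hj₀⟩ := hnot
        have hpm : ∏ j, q ^ (α j) ≤ q ^ m := by
          rw [Finset.prod_pow_eq_pow_sum]
          refine pow_le_pow_of_le_one h0 h1.le (hj₀.trans ?_)
          exact Finset.single_le_sum (f := α) (fun _ _ => Nat.zero_le _) (Finset.mem_univ j₀)
        have hφ : ‖∏ j, (φ z j) ^ (α j)‖ ≤ (∏ j, q ^ (α j)) * ∏ j, q ^ (α j) := by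
          rw [norm_prod, ← Finset.prod_mul_distrib]
          refine Finset.prod_le_prod (fun _ _ => norm_nonneg _) fun j _ => ?_
          rw [norm_pow, ← mul_pow, ← pow_two]
          exact pow_le_pow_left₀ (norm_nonneg _) (hq z hz j) _
        have hcα : ‖c α‖ ≤ ‖c‖ := lp.norm_apply_le_norm (by norm_num) c α
        rw [norm_mul]
        calc ‖c α‖ * ‖∏ j, (φ z j) ^ (α j)‖
            ≤ ‖c‖ * ((∏ j, q ^ (α j)) * q ^ m) := by
              refine mul_le_mul hcα (hφ.trans ?_) (norm_nonneg _) (norm_nonneg _)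
              exact mul_le_mul_of_nonneg_left hpm hP
          _ = _ := by ring
    have hs2 := hgeom.mul_right (q ^ m * ‖c‖)
    calc _ ≤ ∑' α : Fin d → ℕ, (∏ j, q ^ (α j)) * (q ^ m * ‖c‖) :=
          tsum_of_norm_bounded hs2.hasSum hterm
      _ = K * q ^ m * ‖c‖ := by rw [tsum_mul_right, mul_assoc]

/-- Upper bound for approximation numbers of composition operators whose symbol satisfies
`‖φ‖_∞ < 1`: `a_n(C_φ) ≤ C · exp(−c n^{1/d})`. -/
theorem upper_bound_approx_numbers_polydisk
    (d : ℕ) (hd : 1 ≤ d) (φ : (Fin d → ℂ) → (Fin d → ℂ))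
    (hmaps : Set.MapsTo φ (polydisk d) (polydisk d))
    (hdiff : DifferentiableOn ℂ φ (polydisk d))
    (hsup : ∃ r : ℝ, r < 1 ∧ ∀ z ∈ polydisk d, ∀ j, ‖φ z j‖ ≤ r)
    (T : H2 d →L[ℂ] H2 d) (hT : IsCompositionOperator φ T) :
    ∃ c C : ℝ, 0 < c ∧ c ≤ C ∧ ∀ n : ℕ, 1 ≤ n →
      approxNumber T n ≤ C * Real.exp (-c * (n : ℝ) ^ ((1 : ℝ) / d)) := by
  obtain ⟨r, hr1, hr⟩ := hsup
  set r' := max r (1 / 2) with hr'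
  have hr'0 : 0 < r' := lt_of_lt_of_le (by norm_num) (le_max_right _ _)
  have hr'1 : r' < 1 := max_lt hr1 (by norm_num)
  set q := Real.sqrt r' with hqdef
  have hq0 : 0 < q := Real.sqrt_pos.mpr hr'0
  have hq1 : q < 1 := by
    rw [hqdef, Real.sqrt_lt' one_pos]
    simpa using hr'1
  have hqr : ∀ z ∈ polydisk d, ∀ j, ‖φ z j‖ ≤ q ^ 2 := by
    intro z hz j
    rw [hqdef, Real.sq_sqrt hr'0.le]
    exact (hr z hz j).trans (le_max_left _ _)
  set K := ∑' α : Fin d → ℕ, ∏ j, q ^ (α j) with hK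
  have hK0 : 0 ≤ K := tsum_nonneg fun α => Finset.prod_nonneg fun j _ => pow_nonneg hq0.le _
  have hlog : Real.log q < 0 := Real.log_neg hq0 hq1
  refine ⟨-Real.log q, max (-Real.log q) (K / q), by linarith, le_max_left _ _, fun n hn => ?_⟩
  set x : ℝ := (n : ℝ) ^ ((1 : ℝ) / d) with hx
  have hd0 : d ≠ 0 := by omega
  have hn0 : (0 : ℝ) < n := by exact_mod_cast hn
  have hx0 : 0 < x := Real.rpow_pos_of_pos hn0 _
  have hxd : x ^ d = n := by
    rw [hx, one_div, Real.rpow_inv_natCast_pow hn0.le hd0]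
  obtain ⟨m, hm⟩ : ∃ m, ⌈x⌉₊ = m + 1 :=
    ⟨⌈x⌉₊ - 1, by have := Nat.ceil_pos.mpr hx0; omega⟩
  have hmx : (m : ℝ) < x := Nat.lt_ceil.mp (by omega)
  have hxm : x ≤ m + 1 := by
    have := Nat.le_ceil x
    rw [hm] at this
    exact_mod_cast this
  have hmd : m ^ d < n := by
    have : (m : ℝ) ^ d < n := by
      rw [← hxd]
      exact pow_lt_pow_left₀ hmx (Nat.cast_nonneg _) hd0
    exact_mod_cast this
  obtain ⟨R, hRr, hRn⟩ := aux_trunc φ q hq0.le hq1 hqr T hT m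
  have h1 : approxNumber T n ≤ ‖T - R‖ := by
    refine csInf_le ⟨0, ?_⟩ ⟨R, hRr.trans_lt (by exact_mod_cast hmd), rfl⟩
    rintro _ ⟨R', _, rfl⟩
    exact norm_nonneg _
  have h2 : q ^ m ≤ q⁻¹ * Real.exp (-(-Real.log q) * x) := by
    rw [neg_neg, ← Real.rpow_def_of_pos hq0, ← Real.rpow_natCast, ← Real.rpow_neg_one,
      ← Real.rpow_add hq0]
    exact Real.rpow_le_rpow_of_exponent_ge hq0 hq1.le (by linarith)
  calc approxNumber T n ≤ K * q ^ m := h1.trans hRn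
    _ ≤ K * (q⁻¹ * Real.exp (-(-Real.log q) * x)) := mul_le_mul_of_nonneg_left h2 hK0
    _ = K / q * Real.exp (-(-Real.log q) * x) := by ring
    _ ≤ _ := mul_le_mul_of_nonneg_right (le_max_right _ _) (Real.exp_pos _).le
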